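/- Let X be a real Banach algebra with identity satisfying the sequential condition (P), and let S be a nonempty, bounded, closed and convex subset of X. Let A, C : X → X and B : S → X be weakly sequentially continuous operators such that: (i) A and C are Lipschitz with constants a and c respectively; (ii) A x is invertible in X for every x ∈ X; (iii) B(S) is relatively weakly compact; (iv) whenever x ∈ X satisfies x = A x · B y + C x for some y ∈ S, then x ∈ S. If β·a + c < 1, where β = sup{‖B y‖ : y ∈ S}, then there exists x ∈ S with x = A x · B x + C x. -/

import Mathlib

open Filter Topology Pointwise

variable {X : Type*} [NormedAddCommGroup X] [NormedSpace ℝ X]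

/-- `u` converges weakly to `x`. -/
def WeakConv (u : ℕ → X) (x : X) : Prop :=
  ∀ f : X →L[ℝ] ℝ, Tendsto (fun n => f (u n)) atTop (𝓝 (f x))

/-- A set is weakly compact if it is compact in the weak topology `σ(X, X*)`. -/
def WeaklyCompact (K : Set X) : Prop :=
  IsCompact (toWeakSpace ℝ X '' K)

/-- The closure of a set in the weak topology. -/
def weakClosure (S : Set X) : Set X :=
  toWeakSpace ℝ X ⁻¹' closure (toWeakSpace ℝ X '' S)

/-- A set is relatively weakly compact if its weak closure is weakly compact. -/
def RelWeaklyCompact (S : Set X) : Prop :=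
  WeaklyCompact (weakClosure S)

/-- The De Blasi measure of weak noncompactness. -/
noncomputable def deBlasi (S : Set X) : ℝ :=
  sInf {r : ℝ | 0 ≤ r ∧ ∃ K : Set X, WeaklyCompact K ∧ S ⊆ K + Metric.closedBall (0 : X) r}
/-- Condition (P): the product of weakly convergent sequences converges weakly to the
product of the limits. -/
def CondP (X : Type*) [NormedRing X] [NormedAlgebra ℝ X] : Prop :=
  ∀ (u v : ℕ → X) (x y : X), WeakConv u x → WeakConv v y →
    WeakConv (fun n => u n * v n) (x * y)


section Scarf

open Finset

variable {T I O : Type*} [LinearOrder O]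

/-- A surjection onto a finset with one element fewer has exactly one colliding pair. -/
theorem exists_pair_of_card_image {α β : Type*} [DecidableEq α] [DecidableEq β] {f : α → β}
    {s : Finset α} (h : #s = #(s.image f) + 1) :
    ∃ i ∈ s, ∃ j ∈ s, i ≠ j ∧
      ∀ l ∈ s, (s.erase l).image f = s.image f ↔ l = i ∨ l = j := by
  obtain ⟨i, hi, j, hj, hij, hf⟩ := exists_ne_map_eq_of_card_lt_of_maps_to
    (by omega : #(s.image f) < #s) (fun a ha => mem_image_of_mem f ha)
  have key : ∀ a ∈ s, ∀ b ∈ s, a ≠ b → f a = f b → (s.erase a).image f = s.image f := by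
    intro a ha b hb hab hfab
    refine (image_subset_image (erase_subset _ _)).antisymm ?_
    intro y hy
    obtain ⟨x, hx, rfl⟩ := mem_image.1 hy
    by_cases hxa : x = a
    · subst hxa
      exact mem_image.2 ⟨b, mem_erase.2 ⟨hab.symm, hb⟩, hfab.symm⟩
    · exact mem_image_of_mem f (mem_erase.2 ⟨hxa, hx⟩)
  refine ⟨i, hi, j, hj, hij, fun l hl => ⟨fun hl' => ?_, ?_⟩⟩
  · by_contra! hne
    have hcard : #((s.erase l).image f) = #(s.erase l) := by
      rw [hl', card_erase_of_mem hl]; omega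
    exact hij (card_image_iff.1 hcard (mem_coe.2 (mem_erase.2 ⟨hne.1.symm, hi⟩))
      (mem_coe.2 (mem_erase.2 ⟨hne.2.symm, hj⟩)) hf)
  · rintro (rfl | rfl)
    · exact key _ hi _ hj hij hf
    · exact key _ hj _ hi hij.symm hf.symm

/-- `σ` is dominant for `C` if no point exceeds all of `σ` in every order indexed by `C`. -/
def ScarfDominant (k : I → T → O) (σ : Finset T) (C : Finset I) : Prop :=
  ∀ y, ∃ i ∈ C, ∀ x ∈ σ, k i y ≤ k i x

theorem ScarfDominant.mono {k : I → T → O} {σ τ : Finset T} {C D : Finset I}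
    (h : ScarfDominant k σ C) (hτ : τ ⊆ σ) (hC : C ⊆ D) : ScarfDominant k τ D := fun y =>
  let ⟨i, hi, hy⟩ := h y
  ⟨i, hC hi, fun x hx => hy x (hτ hx)⟩

/-- A dominant pair whose components have equal cardinality. -/
def ScarfRoom (k : I → T → O) (r : Finset T × Finset I) : Prop :=
  ScarfDominant k r.1 r.2 ∧ #r.1 = #r.2

/-- The coordinatewise minimum map of a dominant pair is onto. -/
theorem ScarfDominant.image_eq [DecidableEq T] {k : I → T → O} (hk : ∀ i, Function.Injective (k i))
    {σ : Finset T} {C : Finset I} (h : ScarfDominant k σ C) {m : I → T} (hm : ∀ i, m i ∈ σ)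
    (hmin : ∀ i, ∀ x ∈ σ, k i (m i) ≤ k i x) : C.image m = σ := by
  refine Finset.Subset.antisymm (image_subset_iff.2 fun i _ => hm i) fun x hx => ?_
  obtain ⟨i, hi, h'⟩ := h x
  exact mem_image.2 ⟨i, hi, hk i ((hmin i x hx).antisymm (h' _ (hm i)))⟩

theorem room_cases [DecidableEq T] [DecidableEq I] {τ : Finset T} {D : Finset I}
    (hcard : #D = #τ + 1) {r : Finset T × Finset I} (hr : #r.1 = #r.2)
    (h1 : τ ⊆ r.1) (h2 : r.2 ⊆ D) :
    (∃ l ∈ D, r = (τ, D.erase l)) ∨ ∃ x ∉ τ, r = (insert x τ, D) := by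
  obtain ⟨σ, C⟩ := r
  simp only at hr h1 h2 ⊢
  have a1 := card_le_card h1
  have a2 := card_le_card h2
  by_cases hc : #σ = #τ
  · left
    have hσ : τ = σ := eq_of_subset_of_card_le h1 hc.le
    obtain ⟨l, hl⟩ : ∃ l, D \ C = {l} := by
      rw [← card_eq_one, card_sdiff_of_subset h2]; omega
    have hlD : l ∈ D \ C := by simp [hl]
    refine ⟨l, (mem_sdiff.1 hlD).1, Prod.ext hσ.symm ?_⟩
    rw [erase_eq, ← hl]
    exact (Finset.sdiff_sdiff_eq_self h2).symm
  · right
    have hC : C = D := eq_of_subset_of_card_le h2 (by omega)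
    obtain ⟨x, hx⟩ : ∃ x, σ \ τ = {x} := by
      rw [← card_eq_one, card_sdiff_of_subset h1]; omega
    have hxσ : x ∈ σ \ τ := by simp [hx]
    refine ⟨x, (mem_sdiff.1 hxσ).2, Prod.ext ?_ hC⟩
    rw [insert_eq, ← hx]
    exact (sdiff_union_of_subset h1).symm

/-- A dominant pair with a nonempty first component that is one element short lies in exactly
two rooms. -/
theorem exists_two_rooms [Fintype T] {k : I → T → O} (hk : ∀ i, Function.Injective (k i))
    {τ : Finset T} {D : Finset I} (hτ : τ.Nonempty) (hdom : ScarfDominant k τ D)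
    (hcard : #D = #τ + 1) :
    ∃ r₁ r₂, r₁ ≠ r₂ ∧ ∀ r, ScarfRoom k r ∧ τ ⊆ r.1 ∧ r.2 ⊆ D ↔ r = r₁ ∨ r = r₂ := by
  classical
  choose m hm hmin using fun i => exists_min_image τ (k i) hτ
  have him := hdom.image_eq hk hm hmin
  obtain ⟨i, hi, j, hj, hij, hl⟩ := exists_pair_of_card_image (f := m) (by rw [him, hcard])
  rw [him] at hl
  -- the room lying across the index `l`
  let P : I → Finset T × Finset I → Prop := fun l r =>
    ScarfRoom k r ∧ (r = (τ, D.erase l) ∨ ∃ x, r = (insert x τ, D) ∧ x ∉ τ ∧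
      k l x < k l (m l) ∧ ∀ l' ∈ D, l' ≠ l → k l' (m l') < k l' x)
  have hex : ∀ l ∈ D, (D.erase l).image m = τ → ∃ r, P l r := by
    intro l hlD hlim
    by_cases hne : (univ.filter fun y => ∀ l' ∈ D, l' ≠ l → k l' (m l') < k l' y).Nonempty
    · obtain ⟨x, hx, hmax⟩ := exists_max_image _ (k l) hne
      simp only [mem_filter, mem_univ, true_and] at hx hmax
      have hxτ : x ∉ τ := by
        intro hxτ
        rw [← hlim] at hxτ
        obtain ⟨l', hl', rfl⟩ := mem_image.1 hxτ
        exact lt_irrefl _ (hx l' (mem_erase.1 hl').2 (mem_erase.1 hl').1)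
      have hxl : k l x < k l (m l) := by
        obtain ⟨l', hl', hle⟩ := hdom x
        by_cases h : l' = l
        · subst h
          refine lt_of_le_of_ne (hle _ (hm _)) fun h => hxτ ?_
          rw [hk _ h]; exact hm _
        · exact absurd (hle _ (hm _)) (not_le.2 (hx l' hl' h))
      refine ⟨(insert x τ, D), ⟨fun y => ?_, ?_⟩, Or.inr ⟨x, rfl, hxτ, hxl, hx⟩⟩
      · by_cases hy : ∀ l' ∈ D, l' ≠ l → k l' (m l') < k l' y
        · refine ⟨l, hlD, fun z hz => ?_⟩
          rcases mem_insert.1 hz with rfl | hz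
          · exact hmax y hy
          · exact (hmax y hy).trans (hxl.le.trans (hmin l z hz))
        · push Not at hy
          obtain ⟨l', hl', hne', hle⟩ := hy
          refine ⟨l', hl', fun z hz => ?_⟩
          rcases mem_insert.1 hz with rfl | hz
          · exact hle.trans (hx l' hl' hne').le
          · exact hle.trans (hmin l' z hz)
      · simp [card_insert_of_notMem hxτ, hcard]
    · refine ⟨(τ, D.erase l), ⟨fun y => ?_, ?_⟩, Or.inl rfl⟩
      · by_contra! hy
        refine hne ⟨y, mem_filter.2 ⟨mem_univ _, fun l' hl' hne' => ?_⟩⟩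
        obtain ⟨x, hx, hlt⟩ := hy l' (mem_erase.2 ⟨hne', hl'⟩)
        exact (hmin l' x hx).trans_lt hlt
      · simp [card_erase_of_mem hlD, hcard]
  have huniq : ∀ l ∈ D, ∀ r r', P l r → P l r' → r = r' := by
    have mixed : ∀ l ∈ D, ∀ x, ScarfDominant k τ (D.erase l) →
        (∀ l' ∈ D, l' ≠ l → k l' (m l') < k l' x) → False := by
      intro l _ x hdom' hx
      obtain ⟨l', hl', hle⟩ := hdom' x
      exact absurd (hle _ (hm l')) (not_le.2 (hx l' (mem_erase.1 hl').2 (mem_erase.1 hl').1))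
    have le : ∀ l ∈ D, ∀ x y, ScarfDominant k (insert x τ) D →
        (∀ l' ∈ D, l' ≠ l → k l' (m l') < k l' y) → k l y ≤ k l x := by
      intro l _ x y hdom' hy
      obtain ⟨l', hl', hle⟩ := hdom' y
      by_cases h : l' = l
      · subst h; exact hle _ (mem_insert_self _ _)
      · exact absurd (hle _ (mem_insert_of_mem (hm l'))) (not_le.2 (hy l' hl' h))
    rintro l hlD r r' ⟨hr, rfl | ⟨x, rfl, hxτ, hx, hx'⟩⟩ ⟨hr', rfl | ⟨y, rfl, hyτ, hy, hy'⟩⟩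
    · rfl
    · exact (mixed l hlD y hr.1 hy').elim
    · exact (mixed l hlD x hr'.1 hx').elim
    · rw [hk l ((le l hlD y x hr'.1 hx').antisymm (le l hlD x y hr.1 hy'))]
  have hdisj : ∀ r, P i r → P j r → False := by
    rintro r ⟨hr, rfl | ⟨x, rfl, hxτ, hx, hx'⟩⟩ ⟨hr', h | ⟨y, h, hyτ, hy, hy'⟩⟩
    · have := congrArg Prod.snd h
      exact hij ((erase_inj D hi).1 this)
    · have h1 : τ = insert y τ := congrArg Prod.fst h
      exact hyτ (h1 ▸ mem_insert_self y τ)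
    · have h1 : insert x τ = τ := congrArg Prod.fst h
      exact hxτ (h1 ▸ mem_insert_self x τ)
    · have h1 : insert x τ = insert y τ := congrArg Prod.fst h
      have hxy : x ∈ insert y τ := h1 ▸ mem_insert_self x τ
      rcases mem_insert.1 hxy with rfl | hxy
      · exact lt_asymm hx (hy' i hi hij)
      · exact hxτ hxy
  obtain ⟨r₁, hr₁⟩ := hex i hi ((hl i hi).2 (Or.inl rfl))
  obtain ⟨r₂, hr₂⟩ := hex j hj ((hl j hj).2 (Or.inr rfl))
  have hinc : ∀ l r, P l r → ScarfRoom k r ∧ τ ⊆ r.1 ∧ r.2 ⊆ D := by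
    rintro l r ⟨hr, rfl | ⟨x, rfl, -⟩⟩
    · exact ⟨hr, Subset.rfl, erase_subset _ _⟩
    · exact ⟨hr, subset_insert _ _, Subset.rfl⟩
  refine ⟨r₁, r₂, fun h => hdisj r₁ hr₁ (h ▸ hr₂), fun r => ⟨?_, ?_⟩⟩
  · rintro ⟨hr, h1, h2⟩
    suffices ∃ l ∈ D, (D.erase l).image m = τ ∧ P l r by
      obtain ⟨l, hlD, hlim, hP⟩ := this
      rcases (hl l hlD).1 hlim with rfl | rfl
      · exact Or.inl (huniq _ hlD _ _ hP hr₁)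
      · exact Or.inr (huniq _ hlD _ _ hP hr₂)
    rcases room_cases hcard hr.2 h1 h2 with ⟨l, hlD, rfl⟩ | ⟨x, hxτ, rfl⟩
    · exact ⟨l, hlD, hr.1.image_eq hk hm hmin, hr, Or.inl rfl⟩
    · choose m' hm' hmin' using fun i => exists_min_image (insert x τ) (k i) (insert_nonempty x τ)
      have him' : D.image m' = insert x τ := hr.1.image_eq hk hm' hmin'
      have hinj : Set.InjOn m' D := card_image_iff.1 (by rw [him']; exact hr.2)
      obtain ⟨l, hlD, hlx⟩ := mem_image.1 (him' ▸ mem_insert_self x τ)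
      have hmm : ∀ l' ∈ D, l' ≠ l → m' l' = m l' := by
        intro l' hl' hne
        have h1 : m' l' ∈ τ := (mem_insert.1 (hm' l')).resolve_left fun h =>
          hne (hinj hl' hlD (h.trans hlx.symm))
        exact hk l' ((hmin' l' _ (mem_insert_of_mem (hm l'))).antisymm (hmin l' _ h1))
      have hlt : ∀ l', m' l' ≠ x → k l' (m' l') < k l' x := fun l' h =>
        lt_of_le_of_ne (hmin' l' x (mem_insert_self _ _)) fun h' => h (hk l' h')
      refine ⟨l, hlD, ?_, hr, Or.inr ⟨x, rfl, hxτ, ?_, fun l' hl' hne => ?_⟩⟩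
      · refine Finset.Subset.antisymm (image_subset_iff.2 fun i _ => hm i) fun z hz => ?_
        obtain ⟨l', hl', rfl⟩ := mem_image.1 (him' ▸ mem_insert_of_mem hz)
        have hne : l' ≠ l := by
          rintro rfl
          exact hxτ (hlx ▸ hz)
        exact mem_image.2 ⟨l', mem_erase.2 ⟨hne, hl'⟩, (hmm l' hl' hne).symm⟩
      · have := hmin' l _ (mem_insert_of_mem (hm l))
        rw [hlx] at this
        exact lt_of_le_of_ne this fun h => hxτ (hk l h ▸ hm l)
      · rw [← hmm l' hl' hne]
        exact hlt l' fun h => hne (hinj hl' hlD (h.trans hlx.symm))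
  · rintro (rfl | rfl)
    · exact hinc _ _ hr₁
    · exact hinc _ _ hr₂

/-- A room that is not fully coloured meets an even number of almost coloured doors. -/
theorem even_card_doors [DecidableEq T] [DecidableEq I] [Fintype T] [Fintype I]
    {σ : Finset T} {C : Finset I} (hcard : #σ = #C) (c : T → I) (i₀ : I) (hcol : σ.image c ≠ C)
    [DecidablePred fun d : Finset T × Finset I => i₀ ∈ d.2 ∧ d.1.image c = d.2.erase i₀ ∧
      #d.2 = #d.1 + 1 ∧ d.1 ⊆ σ ∧ C ⊆ d.2] :
    Even #(univ.filter fun d : Finset T × Finset I => i₀ ∈ d.2 ∧ d.1.image c = d.2.erase i₀ ∧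
      #d.2 = #d.1 + 1 ∧ d.1 ⊆ σ ∧ C ⊆ d.2) := by
  set W := univ.filter fun d : Finset T × Finset I => i₀ ∈ d.2 ∧ d.1.image c = d.2.erase i₀ ∧
      #d.2 = #d.1 + 1 ∧ d.1 ⊆ σ ∧ C ⊆ d.2 with hW
  suffices W = ∅ ∨ ∃ d₁ d₂, d₁ ≠ d₂ ∧ W = {d₁, d₂} by
    rcases this with h | ⟨d₁, d₂, hne, h⟩
    · simp [h]
    · rw [h, card_pair hne]; exact even_two
  have hcases : ∀ d ∈ W, (i₀ ∈ C ∧ ∃ x ∈ σ, d = (σ.erase x, C) ∧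
        (σ.erase x).image c = C.erase i₀) ∨
      (i₀ ∈ C ∧ ∃ i ∉ C, d = (σ, insert i C) ∧ σ.image c = (insert i C).erase i₀) := by
    rintro ⟨τ, D⟩ hd
    simp only [hW, mem_filter, mem_univ, true_and] at hd
    obtain ⟨h0, him, hc, h1, h2⟩ := hd
    rcases room_cases (r := (σ, C)) hc hcard h1 h2 with ⟨l, hlD, h⟩ | ⟨x, hx, h⟩
    · right
      obtain ⟨rfl, rfl⟩ := Prod.mk.inj h
      have hne : i₀ ≠ l := by rintro rfl; exact hcol him
      refine ⟨mem_erase.2 ⟨hne, h0⟩, l, notMem_erase _ _, ?_, ?_⟩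
      · rw [insert_erase hlD]
      · rw [insert_erase hlD, him]
    · left
      obtain ⟨rfl, rfl⟩ := Prod.mk.inj h
      exact ⟨h0, x, mem_insert_self _ _, by rw [erase_insert hx], by rw [erase_insert hx, him]⟩
  have hmem1 : ∀ x ∈ σ, i₀ ∈ C → (σ.erase x).image c = C.erase i₀ → (σ.erase x, C) ∈ W := by
    intro x hx h0 h
    simp only [hW, mem_filter, mem_univ, true_and]
    refine ⟨h0, h, ?_, erase_subset _ _, Subset.rfl⟩
    rw [card_erase_of_mem hx, ← hcard]
    have := card_pos.2 ⟨x, hx⟩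
    omega
  have hmem2 : ∀ i ∉ C, i₀ ∈ C → σ.image c = (insert i C).erase i₀ → (σ, insert i C) ∈ W := by
    intro i hi h0 h
    simp only [hW, mem_filter, mem_univ, true_and]
    exact ⟨mem_insert_of_mem h0, h, by rw [card_insert_of_notMem hi, hcard], Subset.rfl,
      subset_insert _ _⟩
  by_cases h0 : i₀ ∈ C
  swap
  · left
    refine eq_empty_of_forall_notMem fun d hd => ?_
    rcases hcases d hd with h | h <;> exact h0 h.1
  have hCpos : 0 < #C := card_pos.2 ⟨i₀, h0⟩
  by_cases hA : σ.image c = C.erase i₀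
  · right
    obtain ⟨x, hx, y, hy, hxy, hiff⟩ := exists_pair_of_card_image (f := c) (s := σ)
      (by rw [hA, card_erase_of_mem h0]; omega)
    rw [hA] at hiff
    refine ⟨(σ.erase x, C), (σ.erase y, C), fun h => hxy ((erase_inj σ hx).1
      (congrArg Prod.fst h)), ?_⟩
    ext d
    simp only [mem_insert, mem_singleton]
    constructor
    · intro hd
      rcases hcases d hd with ⟨-, z, hz, rfl, h⟩ | ⟨-, i, hi, rfl, h⟩
      · rcases (hiff z hz).1 h with rfl | rfl <;> simp
      · exfalso
        have : i ∈ C.erase i₀ := by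
          rw [← hA, h]
          exact mem_erase.2 ⟨fun h => hi (h ▸ h0), mem_insert_self _ _⟩
        exact hi (mem_erase.1 this).2
    · rintro (rfl | rfl)
      · exact hmem1 x hx h0 ((hiff x hx).2 (Or.inl rfl))
      · exact hmem1 y hy h0 ((hiff y hy).2 (Or.inr rfl))
  by_cases hB : ∃ i ∉ C, σ.image c = (insert i C).erase i₀
  · right
    obtain ⟨i, hi, him⟩ := hB
    have hi0 : i ≠ i₀ := fun h => hi (h ▸ h0)
    have hinj : Set.InjOn c σ := card_image_iff.1 (by
      rw [him, card_erase_of_mem (mem_insert_of_mem h0), card_insert_of_notMem hi]; omega)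
    have hiim : i ∈ σ.image c := by
      rw [him]; exact mem_erase.2 ⟨hi0, mem_insert_self _ _⟩
    obtain ⟨x, hx, hxi⟩ := mem_image.1 hiim
    have hxim : (σ.erase x).image c = C.erase i₀ := by
      ext l
      have hl : l ∈ σ.image c ↔ l ∈ (insert i C).erase i₀ := by rw [him]
      simp only [mem_image, mem_erase, mem_insert] at hl ⊢
      constructor
      · rintro ⟨z, ⟨hzx, hz⟩, rfl⟩
        obtain ⟨hz0, h⟩ := hl.1 ⟨z, hz, rfl⟩
        exact ⟨hz0, h.resolve_left fun h => hzx (hinj hz hx (h.trans hxi.symm))⟩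
      · rintro ⟨hl0, hlC⟩
        obtain ⟨z, hz, rfl⟩ := hl.2 ⟨hl0, Or.inr hlC⟩
        refine ⟨z, ⟨?_, hz⟩, rfl⟩
        rintro rfl
        exact hi (hxi ▸ hlC)
    refine ⟨(σ.erase x, C), (σ, insert i C), fun h => ?_, ?_⟩
    · have h1 : σ.erase x = σ := congrArg Prod.fst h
      exact erase_eq_self.1 h1 hx
    ext d
    simp only [mem_insert, mem_singleton]
    constructor
    · intro hd
      rcases hcases d hd with ⟨-, z, hz, rfl, h⟩ | ⟨-, j, hj, rfl, h⟩
      · left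
        by_contra hne
        have hzx : x ≠ z := by rintro rfl; exact hne rfl
        have : i ∈ C.erase i₀ := by
          rw [← h, ← hxi]; exact mem_image_of_mem c (mem_erase.2 ⟨hzx, hx⟩)
        exact hi (mem_erase.1 this).2
      · right
        have : i ∈ (insert j C).erase i₀ := by rw [← h]; exact hiim
        rw [((mem_insert.1 (mem_erase.1 this).2).resolve_right hi)]
    · rintro (rfl | rfl)
      · exact hmem1 x hx h0 hxim
      · exact hmem2 i hi h0 him
  · left
    refine eq_empty_of_forall_notMem fun d hd => ?_
    rcases hcases d hd with ⟨-, x, hx, rfl, h⟩ | ⟨-, i, hi, rfl, h⟩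
    · have hsplit : σ.image c = insert (c x) (C.erase i₀) := by
        rw [← h, ← image_insert, insert_erase hx]
      by_cases hcx : c x ∈ C
      · by_cases hcx0 : c x = i₀
        · exact hcol (by rw [hsplit, hcx0, insert_erase h0])
        · exact hA (by rw [hsplit, insert_eq_self.2 (mem_erase.2 ⟨hcx0, hcx⟩)])
      · refine hB ⟨c x, hcx, ?_⟩
        have hne : c x ≠ i₀ := fun h' => hcx (h' ▸ h0)
        rw [hsplit, erase_insert_of_ne hne]
    · exact hB ⟨i, hi, h⟩

/-- **Scarf's lemma** for a colouring: some dominant pair is fully coloured. -/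
theorem exists_scarfDominant_image_eq [DecidableEq I] [Fintype T] [Nonempty T] [Fintype I]
    [Nonempty I] {k : I → T → O} (hk : ∀ i, Function.Injective (k i)) (c : T → I) :
    ∃ (σ : Finset T) (C : Finset I), ScarfDominant k σ C ∧ σ.image c = C := by
  classical
  by_contra! hno
  obtain ⟨i₀⟩ := ‹Nonempty I›
  let R : Finset (Finset T × Finset I) := univ.filter (ScarfRoom k)
  let N : Finset (Finset T × Finset I) := univ.filter fun d =>
    ScarfDominant k d.1 d.2 ∧ i₀ ∈ d.2 ∧ d.1.image c = d.2.erase i₀ ∧ #d.2 = #d.1 + 1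
  let inc : Finset T × Finset I → Finset T × Finset I → Prop := fun d r => d.1 ⊆ r.1 ∧ r.2 ⊆ d.2
  have hdouble := sum_card_bipartiteAbove_eq_sum_card_bipartiteBelow (s := N) (t := R) inc
  have hR : Even (∑ r ∈ R, #(N.bipartiteBelow inc r)) := by
    refine even_sum _ fun r hr => ?_
    have hr : ScarfRoom k r := (mem_filter.1 hr).2
    refine Eq.subst (motive := fun s : Finset (Finset T × Finset I) => Even #s) ?_
      (even_card_doors hr.2 c i₀ (hno r.1 r.2 hr.1))
    symm
    ext d
    simp only [bipartiteBelow, N, inc, mem_filter, mem_univ, true_and]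
    constructor
    · rintro ⟨⟨-, h1, h2, h3⟩, h4, h5⟩
      exact ⟨h1, h2, h3, h4, h5⟩
    · rintro ⟨h1, h2, h3, h4, h5⟩
      exact ⟨⟨hr.1.mono h4 h5, h1, h2, h3⟩, h4, h5⟩
  have hmemN : ((∅ : Finset T), ({i₀} : Finset I)) ∈ N := by
    refine mem_filter.2 ⟨mem_univ _, fun y => ⟨i₀, mem_singleton_self _, by simp⟩, by simp⟩
  have hN : Odd (∑ d ∈ N, #(R.bipartiteAbove inc d)) := by
    rw [← add_sum_erase N _ hmemN]
    refine Odd.add_even ?_ (even_sum _ fun d hd => ?_)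
    · obtain ⟨x, -, hx⟩ := exists_max_image (univ : Finset T) (k i₀) univ_nonempty
      convert odd_one
      rw [card_eq_one]
      refine ⟨({x}, {i₀}), ?_⟩
      ext r
      simp only [bipartiteAbove, R, inc, mem_filter, mem_univ, true_and, mem_singleton]
      constructor
      · rintro ⟨hr, h1, h2⟩
        rcases room_cases (τ := (∅ : Finset T)) (D := {i₀}) (by simp) hr.2 h1 h2 with
          ⟨l, hl, rfl⟩ | ⟨y, -, rfl⟩
        · obtain ⟨i, hi, -⟩ := hr.1 x
          simp [mem_singleton.1 hl] at hi
        · obtain ⟨i, hi, hle⟩ := hr.1 x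
          simp only [mem_singleton] at hi
          subst hi
          have := hle y (mem_insert_self _ _)
          rw [hk i (this.antisymm (hx y (mem_univ y)))]
          rfl
      · rintro rfl
        exact ⟨⟨fun y => ⟨i₀, by simp, fun z hz => by
          rw [mem_singleton.1 hz]; exact hx y (mem_univ y)⟩, by simp⟩, by simp, by simp⟩
    · obtain ⟨hne, hd⟩ := mem_erase.1 hd
      obtain ⟨-, hdom, h0, him, hc⟩ := mem_filter.1 hd
      have hτ : d.1.Nonempty := by
        rw [nonempty_iff_ne_empty]
        intro h
        apply hne
        rw [h, image_empty] at him
        refine Prod.ext h ?_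
        rw [← insert_erase h0, ← him]
        rfl
      obtain ⟨r₁, r₂, hr, hiff⟩ := exists_two_rooms hk hτ hdom hc
      have : R.bipartiteAbove inc d = {r₁, r₂} := by
        ext r
        simp only [bipartiteAbove, R, inc, mem_filter, mem_univ, true_and, mem_insert,
          mem_singleton, hiff]
      rw [this, card_pair hr]
      exact even_two
  rw [hdouble] at hN
  exact (Nat.not_even_iff_odd.2 hN) hR

end Scarf

section Brouwer

variable {ι : Type*} [Fintype ι] [Nonempty ι]

theorem exists_approx_le (f : stdSimplex ℝ ι → stdSimplex ℝ ι) {ε : ℝ} (hε : 0 < ε) :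
    ∃ x₀ : stdSimplex ℝ ι, ∀ i, x₀.1 i ≤ ε ∨
      ∃ x : stdSimplex ℝ ι, dist x x₀ ≤ ε ∧ x.1 i ≤ (f x).1 i := by
  classical
  set N : ℝ := (Fintype.card ι : ℝ) with hN
  have hNpos : 0 < N := by simp [hN, Fintype.card_pos]
  set δ := ε / N with hδ
  have hδpos : 0 < δ := by positivity
  obtain ⟨t, -, ht, hcover⟩ := finite_cover_balls_of_compact
    (isCompact_univ : IsCompact (Set.univ : Set (stdSimplex ℝ ι))) hδpos
  have : Fintype t := ht.fintype
  have hnet : ∀ p : stdSimplex ℝ ι, ∃ y : t, dist p y.1 < δ := fun p => by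
    obtain ⟨y, hy, h⟩ := Set.mem_iUnion₂.1 (hcover (Set.mem_univ p))
    exact ⟨⟨y, hy⟩, h⟩
  have : Nonempty t := by
    classical
    obtain ⟨y, -⟩ := hnet ⟨_, single_mem_stdSimplex ℝ (Classical.arbitrary ι)⟩
    exact ⟨y⟩
  have hcol : ∀ x : t, ∃ i, x.1.1 i ≤ (f x.1).1 i := fun x => by
    obtain ⟨i, -, hi⟩ := Finset.exists_le_of_sum_le (s := Finset.univ)
      (f := x.1.1) (g := (f x.1).1) Finset.univ_nonempty
      (by rw [x.1.2.2, (f x.1).2.2])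
    exact ⟨i, hi⟩
  choose c hc using hcol
  let k : ι → t → Lex (ℝ × Fin (Fintype.card t)) := fun i x =>
    toLex (x.1.1 i, Fintype.equivFin t x)
  have hk : ∀ i, Function.Injective (k i) := fun i x y h =>
    (Fintype.equivFin t).injective (congrArg Prod.snd (toLex.injective h))
  obtain ⟨σ, C, hdom, him⟩ := exists_scarfDominant_image_eq hk c
  have hCne : C.Nonempty := by
    obtain ⟨i, hi, -⟩ := hdom (Classical.arbitrary t)
    exact ⟨i, hi⟩
  have hσ : σ.Nonempty := by rw [← him] at hCne; exact Finset.image_nonempty.1 hCne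
  choose m hm hmin using fun i => Finset.exists_min_image σ (fun x => x.1.1 i) hσ
  have hsum : 1 - ε ≤ ∑ i ∈ C, (m i).1.1 i := by
    by_contra! hlt
    set s := (1 - ∑ i ∈ C, (m i).1.1 i) / C.card with hs
    have hCpos : (0 : ℝ) < C.card := by exact_mod_cast hCne.card_pos
    have hCN : (C.card : ℝ) ≤ N := by rw [hN]; exact_mod_cast Finset.card_le_univ C
    have hsδ : δ ≤ s := by
      rw [hδ, hs]
      have hM : ε ≤ 1 - ∑ i ∈ C, (m i).1.1 i := by linarith
      exact div_le_div₀ (by linarith) hM hCpos hCN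
    have hp : (fun i => if i ∈ C then (m i).1.1 i + s else 0) ∈ stdSimplex ℝ ι := by
      refine ⟨fun i => ?_, ?_⟩
      · dsimp only
        split_ifs
        · have := (m i).1.2.1 i; linarith
        · exact le_rfl
      · rw [Finset.sum_ite_mem, Finset.univ_inter, Finset.sum_add_distrib, Finset.sum_const,
          nsmul_eq_mul, hs]
        field_simp
        ring
    obtain ⟨y, hy⟩ := hnet ⟨_, hp⟩
    obtain ⟨i, hi, hle⟩ := hdom y
    have h1 := (dist_le_pi_dist _ _ i).trans_lt hy
    simp only [hi, if_true] at h1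
    rw [Real.dist_eq] at h1
    have h2 := (abs_lt.1 h1).2
    have h3 : k i (m i) < k i y := Prod.Lex.lt_iff.2 (Or.inl (by
      change (m i).1.1 i < y.1.1 i
      linarith))
    exact absurd (hle _ (hm i)) (not_le.2 h3)
  have hbound : ∀ x ∈ σ, (∀ i ∈ C, x.1.1 i - (m i).1.1 i ≤ ε) ∧ ∀ i ∉ C, x.1.1 i ≤ ε := by
    intro x hx
    have hx1 := x.1.2.2
    rw [← Finset.sum_add_sum_compl C] at hx1
    have hnn : ∀ i ∈ C, 0 ≤ x.1.1 i - (m i).1.1 i := fun i _ => sub_nonneg.2 (hmin i x hx)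
    have hnn' : ∀ i ∈ Cᶜ, 0 ≤ x.1.1 i := fun i _ => x.1.2.1 i
    have hd : ∑ i ∈ C, (x.1.1 i - (m i).1.1 i) + ∑ i ∈ Cᶜ, x.1.1 i ≤ ε := by
      rw [Finset.sum_sub_distrib]; linarith
    have p1 := Finset.sum_nonneg hnn
    have p2 := Finset.sum_nonneg hnn'
    refine ⟨fun i hi => ?_, fun i hi => ?_⟩
    · have := Finset.single_le_sum hnn hi
      linarith
    · have := Finset.single_le_sum hnn' (Finset.mem_compl.2 hi)
      linarith
  obtain ⟨x₀, hx₀⟩ := hσ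
  refine ⟨x₀.1, fun i => ?_⟩
  by_cases hi : i ∈ C
  · right
    obtain ⟨x, hx, rfl⟩ := Finset.mem_image.1 (him ▸ hi)
    refine ⟨x.1, ?_, hc x⟩
    rw [Subtype.dist_eq, dist_pi_le_iff hε.le]
    intro j
    rw [Real.dist_eq, abs_le]
    by_cases hj : j ∈ C
    · have h1 := (hbound x hx).1 j hj
      have h2 := (hbound x₀ hx₀).1 j hj
      have h3 := hmin j x hx
      have h4 := hmin j x₀ hx₀
      constructor <;> linarith
    · have h1 := (hbound x hx).2 j hj
      have h2 := (hbound x₀ hx₀).2 j hj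
      have h3 := x.1.2.1 j
      have h4 := x₀.1.2.1 j
      constructor <;> linarith
  · exact Or.inl ((hbound x₀ hx₀).2 i hi)

/-- **Brouwer's fixed point theorem** on the standard simplex. -/
theorem stdSimplex_exists_fixedPoint {f : stdSimplex ℝ ι → stdSimplex ℝ ι} (hf : Continuous f) :
    ∃ x, f x = x := by
  classical
  have hcoord : ∀ i, Continuous fun x : stdSimplex ℝ ι => x.1 i := fun i =>
    (continuous_apply i).comp continuous_subtype_val
  have happrox : ∀ ε > 0, ∃ x : stdSimplex ℝ ι, ∀ i, x.1 i - (f x).1 i ≤ ε := by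
    intro ε hε
    obtain ⟨δ, hδ, hfδ⟩ := Metric.uniformContinuous_iff.1
      (CompactSpace.uniformContinuous_of_continuous hf) (ε / 2) (by positivity)
    obtain ⟨x₀, hx₀⟩ := exists_approx_le f (ε := min (δ / 2) (ε / 2)) (by positivity)
    refine ⟨x₀, fun i => ?_⟩
    have hpos := (f x₀).2.1 i
    rcases hx₀ i with h | ⟨x, hx, hxi⟩
    · have := h.trans (min_le_right _ _)
      linarith
    · have h1 := (dist_le_pi_dist _ _ i).trans (hx.trans (min_le_right _ _))
      have h2 := (dist_le_pi_dist _ _ i).trans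
        (hfδ (show dist x x₀ < δ from (hx.trans (min_le_left _ _)).trans_lt (by linarith))).le
      rw [Real.dist_eq, abs_le] at h1 h2
      linarith [h1.1, h1.2, h2.1, h2.2]
  have : Nonempty (stdSimplex ℝ ι) := ⟨⟨_, single_mem_stdSimplex ℝ (Classical.arbitrary ι)⟩⟩
  obtain ⟨x, -, hx⟩ := (isCompact_univ : IsCompact (Set.univ : Set (stdSimplex ℝ ι))).exists_isMinOn
    Set.univ_nonempty (f := fun x => ∑ i, max 0 (x.1 i - (f x).1 i))
    (continuous_finsetSum _ fun i _ =>
      continuous_const.max ((hcoord i).sub ((hcoord i).comp hf))).continuousOn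
  have hle : ∑ i, max 0 (x.1 i - (f x).1 i) ≤ 0 := by
    refine le_of_forall_pos_le_add fun ε hε => ?_
    obtain ⟨y, hy⟩ := happrox (ε / Fintype.card ι) (by positivity)
    refine (hx (Set.mem_univ y)).trans ?_
    calc ∑ i, max 0 (y.1 i - (f y).1 i) ≤ ∑ _i : ι, ε / Fintype.card ι :=
          Finset.sum_le_sum fun i _ => max_le (by positivity) (hy i)
      _ = 0 + ε := by
          rw [Finset.sum_const, Finset.card_univ, nsmul_eq_mul]
          field_simp
          simp
  have hle' : ∀ i, x.1 i ≤ (f x).1 i := fun i => by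
    have h := (Finset.single_le_sum (f := fun i => max 0 (x.1 i - (f x).1 i))
      (fun i _ => le_max_left _ _) (Finset.mem_univ i)).trans hle
    linarith [(le_max_right 0 (x.1 i - (f x).1 i)).trans h]
  have heq := (Finset.sum_eq_sum_iff_of_le fun i _ => hle' i).1 (x.2.2.trans (f x).2.2.symm)
  exact ⟨x, Subtype.ext (funext fun i => (heq i (Finset.mem_univ i)).symm)⟩

end Brouwer

section Schauder

/-- **Schauder–Tychonoff fixed point theorem** in a space with separating dual. -/
theorem exists_fixedPoint_of_isCompact_of_convex {E : Type*} [AddCommGroup E] [Module ℝ E]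
    [TopologicalSpace E] [IsTopologicalAddGroup E] [ContinuousSMul ℝ E] [SeparatingDual ℝ E]
    {K : Set E} (hK : IsCompact K) (hconv : Convex ℝ K) (hne : K.Nonempty) {N : E → E}
    (hN : ContinuousOn N K) (hmaps : Set.MapsTo N K K) : ∃ x ∈ K, N x = x := by
  classical
  by_contra! hno
  have hF : ContinuousOn (fun x => x - N x) K := continuousOn_id.sub hN
  have hsep : ∀ x ∈ K, ∃ f : E →L[ℝ] ℝ, f (x - N x) ≠ 0 := fun x hx =>
    SeparatingDual.exists_ne_zero (sub_ne_zero.2 (hno x hx).symm)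
  choose! f hf using hsep
  obtain ⟨t, -, ht⟩ := hK.elim_nhdsWithin_subcover (fun x => {y | f x (y - N y) ≠ 0}) fun x hx =>
    (((f x).continuous.comp_continuousOn hF) x hx).eventually_ne (hf x hx)
  let q : E → ℝ := fun e => ∑ a ∈ t, |f a e|
  have hq : Continuous q := continuous_finsetSum _ fun a _ => (f a).continuous.abs
  have hqpos : ∀ x ∈ K, 0 < q (x - N x) := by
    intro x hx
    obtain ⟨a, ha, hax⟩ := Set.mem_iUnion₂.1 (ht hx)
    exact Finset.sum_pos' (fun _ _ => abs_nonneg _) ⟨a, ha, abs_pos.2 hax⟩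
  obtain ⟨x₀, hx₀, hmin⟩ := hK.exists_isMinOn hne (hq.comp_continuousOn hF)
  set ε := q (x₀ - N x₀) / 2 with hε
  have hεpos : 0 < ε := half_pos (hqpos x₀ hx₀)
  obtain ⟨s, hsK, hs⟩ := hK.elim_nhds_subcover (fun y => {z | q (z - y) < ε}) fun y _ => by
    refine (hq.comp (continuous_id.sub continuous_const)).continuousAt.eventually_lt_const ?_
    simpa [q] using hεpos
  have hsne : Nonempty s := by
    obtain ⟨y, hy, -⟩ := Set.mem_iUnion₂.1 (hs hx₀)
    exact ⟨⟨y, hy⟩⟩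
  let w : s → E → ℝ := fun y z => max 0 (ε - q (z - y))
  have hw0 : ∀ y z, 0 ≤ w y z := fun y z => le_max_left _ _
  have hwc : ∀ y, Continuous (w y) := fun y =>
    continuous_const.max (continuous_const.sub (hq.comp (continuous_id.sub continuous_const)))
  have hW : ∀ z ∈ K, 0 < ∑ y, w y z := by
    intro z hz
    obtain ⟨y, hy, hyz⟩ := Set.mem_iUnion₂.1 (hs hz)
    exact Finset.sum_pos' (fun y _ => hw0 y z)
      ⟨⟨y, hy⟩, Finset.mem_univ _, lt_max_of_lt_right (sub_pos.2 hyz)⟩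
  let b : stdSimplex ℝ s → E := fun p => ∑ y, p.1 y • (y : E)
  have hbK : ∀ p, b p ∈ K := fun p =>
    hconv.sum_mem (fun y _ => p.2.1 y) p.2.2 fun y _ => hsK y y.2
  have hb : Continuous b := continuous_finsetSum _ fun y _ =>
    ((continuous_apply y).comp continuous_subtype_val).smul continuous_const
  have hNb : Continuous fun p => N (b p) := hN.comp_continuous hb hbK
  let g : stdSimplex ℝ s → stdSimplex ℝ s := fun p =>
    ⟨fun y => w y (N (b p)) / ∑ y, w y (N (b p)),
      fun y => div_nonneg (hw0 _ _) (hW _ (hmaps (hbK p))).le, by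
        rw [← Finset.sum_div]
        exact div_self (hW _ (hmaps (hbK p))).ne'⟩
  have hg : Continuous g := by
    refine Continuous.subtype_mk (continuous_pi fun y => ?_) _
    exact ((hwc y).comp hNb).div (continuous_finsetSum _ fun y _ => (hwc y).comp hNb)
      fun p => (hW _ (hmaps (hbK p))).ne'
  obtain ⟨p, hp⟩ := stdSimplex_exists_fixedPoint hg
  set u := N (b p) with hu
  have hpy : ∀ y, p.1 y = w y u / ∑ y, w y u := fun y =>
    (congrFun (congrArg Subtype.val hp) y).symm
  have hle : ∀ y, p.1 y * q (y - u) ≤ p.1 y * ε := by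
    intro y
    by_cases h : q (u - y) < ε
    · have hsymm : q ((y : E) - u) = q (u - y) := by
        simp only [q, ← neg_sub u, map_neg, abs_neg]
      rw [hsymm]
      exact mul_le_mul_of_nonneg_left h.le (p.2.1 y)
    · have : p.1 y = 0 := by
        rw [hpy, show w y u = 0 from max_eq_left (by linarith), zero_div]
      simp [this]
  have hsub : b p - u = ∑ y, p.1 y • ((y : E) - u) := by
    simp only [smul_sub, Finset.sum_sub_distrib, ← Finset.sum_smul, p.2.2, one_smul, b]
  have hfin : q (b p - u) ≤ ε := by
    calc q (b p - u) ≤ ∑ y, p.1 y * q (y - u) := by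
          rw [hsub]
          simp only [q, map_sum, map_smul, smul_eq_mul, Finset.mul_sum]
          rw [Finset.sum_comm]
          refine Finset.sum_le_sum fun a _ => (Finset.abs_sum_le_sum_abs _ _).trans_eq ?_
          exact Finset.sum_congr rfl fun y _ => by rw [abs_mul, abs_of_nonneg (p.2.1 y)]
      _ ≤ ∑ y, p.1 y * ε := Finset.sum_le_sum fun y _ => hle y
      _ = ε := by rw [← Finset.sum_mul, p.2.2, one_mul]
  have := hmin (hbK p)
  simp only [Function.comp, Set.mem_ofPred_eq] at this
  linarith

end Schauder

section WeakTopology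

theorem continuous_toWeakSpace_iff {α : Type*} [TopologicalSpace α] {g : α → X} :
    Continuous (fun a => toWeakSpace ℝ X (g a)) ↔ ∀ f : X →L[ℝ] ℝ, Continuous fun a => f (g a) :=
  ⟨fun h f => (WeakBilin.eval_continuous (topDualPairing ℝ X).flip f).comp h,
    fun h => WeakBilin.continuous_of_continuous_eval (topDualPairing ℝ X).flip h⟩

theorem continuous_weakSpace_eval (f : X →L[ℝ] ℝ) :
    Continuous fun x : WeakSpace ℝ X => f ((toWeakSpace ℝ X).symm x) :=
  WeakBilin.eval_continuous (topDualPairing ℝ X).flip f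

instance WeakSpace.instSeparatingDual : SeparatingDual ℝ (WeakSpace ℝ X) where
  exists_ne_zero' x hx := by
    obtain ⟨f, hf⟩ := SeparatingDual.exists_ne_zero (R := ℝ)
      (x := (toWeakSpace ℝ X).symm x) (by simpa using hx)
    exact ⟨⟨(f : X →ₗ[ℝ] ℝ).comp ((toWeakSpace ℝ X).symm : WeakSpace ℝ X →ₗ[ℝ] X),
      continuous_weakSpace_eval f⟩, hf⟩

theorem weakConv_iff_tendsto {u : ℕ → X} {x : X} :
    WeakConv u x ↔ Tendsto (fun n => toWeakSpace ℝ X (u n)) atTop (𝓝 (toWeakSpace ℝ X x)) := by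
  refine (WeakBilin.tendsto_iff_forall_eval_tendsto (topDualPairing ℝ X).flip
    (fun x y h => ?_)).symm
  exact (SeparatingDual.eq_iff_forall_dual_eq (R := ℝ)).2 fun f => DFunLike.congr_fun h f

theorem subset_weakClosure (S : Set X) : S ⊆ weakClosure S :=
  Set.image_subset_iff.1 subset_closure

theorem Filter.Tendsto.weakConv {u : ℕ → X} {x : X} (h : Tendsto u atTop (𝓝 x)) :
    WeakConv u x := fun f => (f.continuous.tendsto x).comp h

theorem isClosed_toWeakSpace_image {S : Set X} (hS : IsClosed S) (hconv : Convex ℝ S) :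
    IsClosed (toWeakSpace ℝ X '' S) := by
  rw [← hS.closure_eq, hconv.toWeakSpace_closure ℝ]
  exact isClosed_closure

theorem WeakConv.mem_of_isClosed {S : Set X} (hS : IsClosed S) (hconv : Convex ℝ S)
    {u : ℕ → X} {x : X} (h : WeakConv u x) (hu : ∀ n, u n ∈ S) : x ∈ S := by
  obtain ⟨y, hy, hyx⟩ := (isClosed_toWeakSpace_image hS hconv).mem_of_tendsto
    (weakConv_iff_tendsto.1 h) (Eventually.of_forall fun n => Set.mem_image_of_mem _ (hu n))
  rwa [← (toWeakSpace ℝ X).injective hyx]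

theorem WeaklyCompact.exists_norm_le {K : Set X} (hK : WeaklyCompact K) :
    ∃ M, ∀ x ∈ K, ‖x‖ ≤ M := by
  obtain ⟨M, hM⟩ := banach_steinhaus
    (g := fun x : K => NormedSpace.inclusionInDoubleDualLi ℝ (x : X)) (fun f => by
      obtain ⟨C, hC⟩ := (hK.image (continuous_weakSpace_eval f)).isBounded.exists_norm_le
      exact ⟨C, fun x => hC _ ⟨_, ⟨x, x.2, rfl⟩, rfl⟩⟩)
  exact ⟨M, fun x hx => by
    simpa only [LinearIsometry.norm_map] using hM ⟨x, hx⟩⟩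

theorem TopologicalSpace.IsSeparable.exists_seq_dual_separating {M : Set X}
    (hM : TopologicalSpace.IsSeparable M) :
    ∃ g : ℕ → X →L[ℝ] ℝ, ∀ x ∈ M, ∀ y ∈ M, x ≠ y → ∃ n, g n x ≠ g n y := by
  obtain ⟨c, hc, hMc⟩ := hM
  obtain ⟨d, hd⟩ := ((hc.prod hc).image fun p => p.1 - p.2).insert 0 |>.exists_eq_range
    (Set.insert_nonempty _ _)
  choose g hg1 hg using fun n => exists_dual_vector'' ℝ (d n)
  refine ⟨g, fun x hx y hy hxy => ?_⟩
  by_contra! hall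
  refine hxy (sub_eq_zero.1 (norm_le_zero_iff.1 (le_of_forall_pos_le_add fun ε hε => ?_)))
  have hmem : x - y ∈ closure (Set.range d) := by
    rw [← hd]
    refine closure_mono (Set.subset_insert _ _) ?_
    have := map_mem_closure (f := fun p : X × X => p.1 - p.2) (s := c ×ˢ c)
      (t := (fun p : X × X => p.1 - p.2) '' c ×ˢ c) (continuous_fst.sub continuous_snd)
      (x := (x, y)) (by rw [closure_prod_eq]; exact ⟨hMc hx, hMc hy⟩)
      fun p hp => Set.mem_image_of_mem _ hp
    exact this
  obtain ⟨_, ⟨n, rfl⟩, hn⟩ := Metric.mem_closure_iff.1 hmem (ε / 2) (by positivity)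
  rw [dist_eq_norm] at hn
  have h1 : ‖d n‖ ≤ ‖x - y - d n‖ := by
    have h0 : g n (d n) = -g n (x - y - d n) := by
      simp [hall n]
    calc ‖d n‖ = ‖g n (d n)‖ := by rw [hg]; simp
      _ = ‖g n (x - y - d n)‖ := by rw [h0, norm_neg]
      _ ≤ 1 * ‖x - y - d n‖ := (g n).le_of_opNorm_le (hg1 n) _
      _ = _ := one_mul _
  have h2 : ‖x - y‖ ≤ ‖x - y - d n‖ + ‖d n‖ := by
    simpa using norm_add_le (x - y - d n) (d n)
  linarith

/-- A weakly compact set that is separable in norm is metrizable in the weak topology. -/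
theorem WeaklyCompact.metrizableSpace {K : Set X} (hK : WeaklyCompact K)
    (hsep : TopologicalSpace.IsSeparable K) :
    TopologicalSpace.MetrizableSpace (toWeakSpace ℝ X '' K) := by
  have : CompactSpace (toWeakSpace ℝ X '' K) := isCompact_iff_compactSpace.1 hK
  obtain ⟨g, hg⟩ := TopologicalSpace.IsSeparable.exists_seq_dual_separating hsep
  refine Metric.PiNatEmbed.TopologicalSpace.MetrizableSpace.of_countable_separating
    (fun n (k : toWeakSpace ℝ X '' K) => g n ((toWeakSpace ℝ X).symm k))
    (fun n => (continuous_weakSpace_eval (g n)).comp continuous_subtype_val) ?_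
  rintro ⟨_, x, hx, rfl⟩ ⟨_, y, hy, rfl⟩ hxy
  exact hg x hx y hy fun h => hxy (by simp [h])

/-- On a separable weakly compact set, weak sequential continuity is weak continuity. -/
theorem WeaklyCompact.continuousOn_of_weakConv {Z : Type*} [NormedAddCommGroup Z]
    [NormedSpace ℝ Z] {K : Set X} (hK : WeaklyCompact K)
    (hsep : TopologicalSpace.IsSeparable K) {T : X → Z}
    (hT : ∀ (u : ℕ → X) (x : X), (∀ n, u n ∈ K) → x ∈ K →
      WeakConv u x → WeakConv (fun n => T (u n)) (T x)) :
    ContinuousOn (fun x => toWeakSpace ℝ Z (T ((toWeakSpace ℝ X).symm x)))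
      (toWeakSpace ℝ X '' K) := by
  have := hK.metrizableSpace hsep
  rw [continuousOn_iff_continuous_domRestrict, continuous_iff_seqContinuous]
  have hmem : ∀ p : toWeakSpace ℝ X '' K, (toWeakSpace ℝ X).symm p ∈ K := by
    rintro ⟨_, x, hx, rfl⟩
    simpa using hx
  intro u x hu
  refine weakConv_iff_tendsto.1 (hT _ _ (fun n => hmem (u n)) (hmem x) ?_)
  rw [weakConv_iff_tendsto]
  simpa [Function.comp_def] using (continuous_subtype_val.tendsto x).comp hu

theorem isSeparable_image_of_weakConv {Y Z : Type*} [PseudoMetricSpace Y] [NormedAddCommGroup Z]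
    [NormedSpace ℝ Z] {M : Set Y} (hM : TopologicalSpace.IsSeparable M) {T : Y → Z}
    (hT : ∀ (u : ℕ → Y) (x : Y), (∀ n, u n ∈ M) → x ∈ M → Tendsto u atTop (𝓝 x) →
      WeakConv (fun n => T (u n)) (T x)) : TopologicalSpace.IsSeparable (T '' M) := by
  obtain ⟨c, hcM, hc, hMc⟩ := hM.exists_countable_dense_subset
  have hspan : TopologicalSpace.IsSeparable
      ((Submodule.span ℝ (T '' c)).topologicalClosure : Set Z) := by
    rw [Submodule.topologicalClosure_coe]
    exact (hc.image T).isSeparable.span.closure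
  refine hspan.mono ?_
  rintro _ ⟨x, hx, rfl⟩
  obtain ⟨u, huc, hu⟩ := mem_closure_iff_seq_limit.1 (hMc hx)
  exact (hT u x (fun n => hcM (huc n)) hx hu).mem_of_isClosed
    (Submodule.isClosed_topologicalClosure _) (Submodule.convex _) fun n =>
      Submodule.le_topologicalClosure _ (Submodule.subset_span ⟨_, huc n, rfl⟩)

/-- A weakly sequentially continuous self-map of a closed convex set leaves some separable
closed convex subset invariant. -/
theorem exists_isSeparable_invariant {S : Set X} (hcl : IsClosed S) (hconv : Convex ℝ S)
    (hne : S.Nonempty) {N : X → X} (hmaps : Set.MapsTo N S S)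
    (hN : ∀ (u : ℕ → X) (x : X), (∀ n, u n ∈ S) → x ∈ S → WeakConv u x →
      WeakConv (fun n => N (u n)) (N x)) :
    ∃ D ⊆ S, D.Nonempty ∧ IsClosed D ∧ Convex ℝ D ∧
      TopologicalSpace.IsSeparable D ∧ Set.MapsTo N D D := by
  obtain ⟨x₀, hx₀⟩ := hne
  let E : ℕ → Set X := fun n => (fun M => convexHull ℝ (M ∪ N '' M))^[n] {x₀}
  have hEsucc : ∀ n, E (n + 1) = convexHull ℝ (E n ∪ N '' E n) := fun n =>
    Function.iterate_succ_apply' _ _ _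
  have hES : ∀ n, E n ⊆ S := by
    intro n
    induction n with
    | zero => simpa [E] using hx₀
    | succ n ih =>
      rw [hEsucc]
      exact convexHull_min (Set.union_subset ih ((Set.image_mono ih).trans hmaps.image_subset))
        hconv
  have hEconv : ∀ n, Convex ℝ (E n) := by
    intro n
    cases n with
    | zero => simp [E]
    | succ n => rw [hEsucc]; exact convex_convexHull ℝ _
  have hEsep : ∀ n, TopologicalSpace.IsSeparable (E n) := by
    intro n
    induction n with
    | zero => simpa [E] using (Set.countable_singleton x₀).isSeparable
    | succ n ih =>
      rw [hEsucc]
      refine TopologicalSpace.IsSeparable.mono (TopologicalSpace.IsSeparable.span (R := ℝ) (ih.union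
        (isSeparable_image_of_weakConv ih fun u x hu hx h => ?_)))
        (convexHull_min Submodule.subset_span (Submodule.convex _))
      exact hN u x (fun n => hES _ (hu n)) (hES _ hx) h.weakConv
  have hEle : ∀ n, E n ⊆ E (n + 1) := fun n => by
    rw [hEsucc]
    exact Set.subset_union_left.trans (subset_convexHull ℝ _)
  have hconvU : Convex ℝ (⋃ n, E n) :=
    (monotone_nat_of_le_succ hEle).directed_le.convex_iUnion hEconv
  have hUS : closure (⋃ n, E n) ⊆ S := hcl.closure_subset_iff.2 (Set.iUnion_subset hES)
  refine ⟨closure (⋃ n, E n), hUS, ⟨x₀, subset_closure (Set.mem_iUnion.2 ⟨0, rfl⟩)⟩,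
    isClosed_closure, hconvU.closure, (TopologicalSpace.IsSeparable.iUnion hEsep).closure,
    fun x hx => ?_⟩
  obtain ⟨u, hu, hux⟩ := mem_closure_iff_seq_limit.1 hx
  refine (hN u x (fun n => hUS (subset_closure (hu n))) (hUS hx) hux.weakConv).mem_of_isClosed
    isClosed_closure hconvU.closure fun n => subset_closure ?_
  obtain ⟨k, hk⟩ := Set.mem_iUnion.1 (hu n)
  refine Set.mem_iUnion.2 ⟨k + 1, ?_⟩
  rw [hEsucc]
  exact subset_convexHull ℝ _ (Or.inr ⟨_, hk, rfl⟩)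

theorem measurable_of_measurableSet_preimage_closedBall {α Z : Type*} [MeasurableSpace α]
    [PseudoMetricSpace Z] [MeasurableSpace Z] [BorelSpace Z] {f : α → Z}
    (hsep : TopologicalSpace.IsSeparable (Set.range f))
    (hf : ∀ x r, MeasurableSet (f ⁻¹' Metric.closedBall x r)) : Measurable f := by
  obtain ⟨c, hc, hfc⟩ := hsep
  have := hc.to_subtype
  refine measurable_of_isOpen fun U hU => ?_
  have hU' : f ⁻¹' U = ⋃ (p : {p : c × ℚ // Metric.closedBall (p.1 : Z) p.2 ⊆ U}),
      f ⁻¹' Metric.closedBall (p.1.1 : Z) p.1.2 := by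
    ext a
    simp only [Set.mem_preimage, Set.mem_iUnion]
    refine ⟨fun ha => ?_, fun ⟨p, hp⟩ => p.2 hp⟩
    obtain ⟨ε, hε, hball⟩ := Metric.isOpen_iff.1 hU _ ha
    obtain ⟨q, hq0, hq⟩ := exists_rat_btwn (half_pos hε)
    obtain ⟨z, hz, hzd⟩ := Metric.mem_closure_iff.1 (hfc ⟨a, rfl⟩) q hq0
    refine ⟨⟨(⟨z, hz⟩, q), fun y hy => hball ?_⟩, hzd.le⟩
    rw [Metric.mem_closedBall] at hy
    rw [Metric.mem_ball]
    have := dist_triangle y z (f a)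
    rw [dist_comm z] at this
    linarith
  rw [hU']
  exact MeasurableSet.iUnion fun p => hf _ _

end WeakTopology

section Composition

open MeasureTheory

/-- The expectation of a weakly continuous function with separable range, as a function of the
probability measure, has a compact convex range in the weak topology. -/
theorem isCompact_convex_range_integral [CompleteSpace X] {Ω : Type*} [TopologicalSpace Ω]
    [CompactSpace Ω] [T2Space Ω] [MeasurableSpace Ω] [BorelSpace Ω] {ψ : Ω → X}
    (hψ : ∀ f : X →L[ℝ] ℝ, Continuous fun ω => f (ψ ω)) (hψint : ∀ μ : ProbabilityMeasure Ω,
      Integrable ψ (μ : Measure Ω)) :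
    IsCompact (toWeakSpace ℝ X '' Set.range fun μ : ProbabilityMeasure Ω => ∫ ω, ψ ω ∂μ) ∧
      Convex ℝ (Set.range fun μ : ProbabilityMeasure Ω => ∫ ω, ψ ω ∂μ) := by
  constructor
  · rw [← Set.range_comp]
    refine isCompact_range (continuous_toWeakSpace_iff.2 fun f => ?_)
    have : (fun μ : ProbabilityMeasure Ω => f (∫ ω, ψ ω ∂μ)) =
        fun μ : ProbabilityMeasure Ω => ∫ ω, f (ψ ω) ∂μ :=
      funext fun μ => (f.integral_comp_comm (hψint μ)).symm
    rw [this, continuous_iff_continuousAt]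
    intro μ
    exact ProbabilityMeasure.tendsto_iff_forall_integral_tendsto.1 tendsto_id
      (BoundedContinuousFunction.mkOfCompact ⟨_, hψ f⟩)
  · rintro _ ⟨μ, rfl⟩ _ ⟨ν, rfl⟩ s t hs ht hst
    have hprob : IsProbabilityMeasure
        (ENNReal.ofReal s • (μ : Measure Ω) + ENNReal.ofReal t • (ν : Measure Ω)) :=
      ⟨by simp [← ENNReal.ofReal_add hs ht, hst]⟩
    refine ⟨⟨_, hprob⟩, ?_⟩
    simp only [ProbabilityMeasure.coe_mk]
    rw [integral_add_measure ((hψint μ).smul_measure ENNReal.ofReal_ne_top)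
      ((hψint ν).smul_measure ENNReal.ofReal_ne_top), integral_smul_measure, integral_smul_measure,
      ENNReal.toReal_ofReal hs, ENNReal.toReal_ofReal ht]

/-- If `B` maps `S` into a weakly compact set and `φ` maps the image of `B` back into `S`, then
`φ ∘ B` has a fixed point in `S`. -/
theorem WeaklyCompact.exists_fixedPoint_comp [CompleteSpace X] {S K : Set X}
    (hK : WeaklyCompact K) (hcl : IsClosed S) (hconv : Convex ℝ S) (hne : S.Nonempty)
    {B φ : X → X} (hBK : Set.MapsTo B S K) (hφS : ∀ x ∈ S, φ (B x) ∈ S)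
    (hB : ∀ (u : ℕ → X) (x : X), (∀ n, u n ∈ S) → x ∈ S → WeakConv u x →
      WeakConv (fun n => B (u n)) (B x))
    (hφ : ∀ (u : ℕ → X) (x : X), (∀ n, u n ∈ K) → x ∈ K → WeakConv u x →
      WeakConv (fun n => φ (u n)) (φ x)) :
    ∃ x ∈ S, φ (B x) = x := by
  have hN : ∀ (u : ℕ → X) (x : X), (∀ n, u n ∈ S) → x ∈ S → WeakConv u x →
      WeakConv (fun n => φ (B (u n))) (φ (B x)) := fun u x hu hx h =>
    hφ _ _ (fun n => hBK (hu n)) (hBK hx) (hB u x hu hx h)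
  obtain ⟨D₀, hD₀S, hD₀ne, hD₀cl, hD₀conv, hD₀sep, hD₀maps⟩ :=
    exists_isSeparable_invariant hcl hconv hne (N := fun x => φ (B x)) hφS hN
  let Y : Submodule ℝ X := (Submodule.span ℝ (B '' D₀)).topologicalClosure
  have hYsep : TopologicalSpace.IsSeparable (Y : Set X) := by
    rw [Submodule.topologicalClosure_coe]
    exact (isSeparable_image_of_weakConv hD₀sep fun u x hu hx h =>
      hB u x (fun n => hD₀S (hu n)) (hD₀S hx) h.weakConv).span.closure
  have hY : ∀ x ∈ D₀, B x ∈ Y := fun x hx =>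
    Submodule.le_topologicalClosure _ (Submodule.subset_span ⟨x, hx, rfl⟩)
  have hL : WeaklyCompact (K ∩ Y) := by
    rw [WeaklyCompact, Set.image_inter (toWeakSpace ℝ X).injective]
    exact hK.inter_right (isClosed_toWeakSpace_image
      (Submodule.isClosed_topologicalClosure _) (Submodule.convex _))
  have hφL := hL.continuousOn_of_weakConv (hYsep.mono Set.inter_subset_right)
    (T := φ) fun u x hu hx => hφ u x (fun n => (hu n).1) hx.1
  have hclosed : ∀ {M : Set X}, IsClosed M → Convex ℝ M →
      IsClosed (toWeakSpace ℝ X '' ((K ∩ Y) ∩ φ ⁻¹' M)) := by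
    intro M hM hMconv
    convert hφL.preimage_isClosed_of_isClosed hL.isClosed (isClosed_toWeakSpace_image hM hMconv)
    ext x
    obtain ⟨x, rfl⟩ := (toWeakSpace ℝ X).surjective x
    simp
  have hK₁ : IsCompact (toWeakSpace ℝ X '' ((K ∩ Y) ∩ φ ⁻¹' D₀)) :=
    hL.of_isClosed_subset (hclosed hD₀cl hD₀conv) (Set.image_mono Set.inter_subset_left)
  set Ω := toWeakSpace ℝ X '' ((K ∩ Y) ∩ φ ⁻¹' D₀) with hΩ
  have : CompactSpace Ω := isCompact_iff_compactSpace.1 hK₁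
  let _ : MeasurableSpace Ω := borel Ω
  have : BorelSpace Ω := ⟨rfl⟩
  let _ : MeasurableSpace X := borel X
  have : BorelSpace X := ⟨rfl⟩
  let ψ : Ω → X := fun ω => φ ((toWeakSpace ℝ X).symm ω)
  have hmem : ∀ ω : Ω, (toWeakSpace ℝ X).symm ω ∈ (K ∩ Y) ∩ φ ⁻¹' D₀ := by
    rintro ⟨_, x, hx, rfl⟩
    simpa using hx
  have hψD : Set.range ψ ⊆ D₀ := by
    rintro _ ⟨ω, rfl⟩
    exact (hmem ω).2
  have hψcont : Continuous fun ω => toWeakSpace ℝ X (ψ ω) :=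
    (hφL.mono (Set.image_mono Set.inter_subset_left)).domRestrict
  have hψsep := hD₀sep.mono hψD
  have hψmeas : StronglyMeasurable ψ :=
    stronglyMeasurable_iff_measurable_separable.2
      ⟨measurable_of_measurableSet_preimage_closedBall hψsep fun x r => by
        have := ((isClosed_toWeakSpace_image Metric.isClosed_closedBall
          (convex_closedBall x r)).preimage hψcont).measurableSet
        rwa [← Function.comp_def, Set.preimage_comp,
          Set.preimage_image_eq _ (toWeakSpace ℝ X).injective] at this, hψsep⟩
  obtain ⟨M, hM⟩ : ∃ M, ∀ x ∈ Set.range ψ, ‖x‖ ≤ M := by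
    refine WeaklyCompact.exists_norm_le ?_
    rw [WeaklyCompact, ← Set.range_comp]
    exact isCompact_range hψcont
  have hψint : ∀ μ : ProbabilityMeasure Ω, Integrable ψ (μ : Measure Ω) := fun μ =>
    Integrable.of_bound hψmeas.aestronglyMeasurable M (Eventually.of_forall fun ω => hM _ ⟨ω, rfl⟩)
  obtain ⟨hDcomp, hDconv⟩ := isCompact_convex_range_integral
    (continuous_toWeakSpace_iff.1 hψcont) hψint
  set D := Set.range fun μ : ProbabilityMeasure Ω => ∫ ω, ψ ω ∂μ with hD
  have hDD₀ : D ⊆ D₀ := by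
    rintro _ ⟨μ, rfl⟩
    exact hD₀conv.integral_mem hD₀cl (Eventually.of_forall fun ω => hψD ⟨ω, rfl⟩) (hψint μ)
  have hψmem : ∀ x ∈ D₀, φ (B x) ∈ D := by
    intro x hx
    let ω : Ω := ⟨toWeakSpace ℝ X (B x), _, ⟨⟨hBK (hD₀S hx), hY x hx⟩, hD₀maps hx⟩, rfl⟩
    refine ⟨⟨Measure.dirac ω, inferInstance⟩, ?_⟩
    simp only [ProbabilityMeasure.coe_mk]
    rw [integral_dirac' _ _ hψmeas]
    simp [ψ, ω]
  obtain ⟨x₀, hx₀⟩ := hD₀ne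
  obtain ⟨_, ⟨x, hx, rfl⟩, hfix⟩ := exists_fixedPoint_of_isCompact_of_convex hDcomp
    (hDconv.linear_image (toWeakSpace ℝ X : X →ₗ[ℝ] WeakSpace ℝ X)) ⟨_, _, hψmem x₀ hx₀, rfl⟩
    (WeaklyCompact.continuousOn_of_weakConv hDcomp (hD₀sep.mono hDD₀)
      (T := fun x => φ (B x)) fun u x hu hx =>
        hN u x (fun n => hD₀S (hDD₀ (hu n))) (hD₀S (hDD₀ hx)))
    (by
      rintro _ ⟨x, hx, rfl⟩
      exact ⟨_, hψmem x (hDD₀ hx), by simp⟩)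
  exact ⟨x, hD₀S (hDD₀ hx), (toWeakSpace ℝ X).injective (by simpa using hfix)⟩

end Composition

section Hybrid

theorem WeakConv.add {u v : ℕ → X} {x y : X} (hu : WeakConv u x) (hv : WeakConv v y) :
    WeakConv (fun n => u n + v n) (x + y) := fun f => by
  simpa using (hu f).add (hv f)

/-- A uniform norm limit of weakly convergent sequences converges weakly. -/
theorem weakConv_of_forall_norm_sub_le {u : ℕ → X} {x : X} {v : ℕ → ℕ → X} {y : ℕ → X}
    {δ : ℕ → ℝ} (hδ : Tendsto δ atTop (𝓝 0)) (hv : ∀ k, WeakConv (v k) (y k))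
    (huv : ∀ k n, ‖v k n - u n‖ ≤ δ k) (hxy : ∀ k, ‖y k - x‖ ≤ δ k) : WeakConv u x := by
  intro f
  have hδf : Tendsto (fun k => ‖f‖ * δ k) atTop (𝓝 0) := by simpa using hδ.const_mul ‖f‖
  have hle : ∀ {k : ℕ} {p q : X}, ‖p - q‖ ≤ δ k → dist (f p) (f q) ≤ ‖f‖ * δ k := fun h => by
    rw [dist_eq_norm, ← map_sub]
    exact f.le_opNorm_of_le h
  have hunif : TendstoUniformly (fun k n => f (v k n)) (fun n => f (u n)) atTop := by
    rw [Metric.tendstoUniformly_iff]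
    intro ε hε
    filter_upwards [hδf.eventually_lt_const hε] with k hk n
    rw [dist_comm]
    exact (hle (huv k n)).trans_lt hk
  exact hunif.tendsto_of_eventually_tendsto (Eventually.of_forall fun k => hv k f)
    (tendsto_iff_dist_tendsto_zero.2
      (squeeze_zero (fun _ => dist_nonneg) (fun k => hle (hxy k)) hδf))

theorem WeakConv.iterate {X : Type*} [NormedRing X] [NormedAlgebra ℝ X] (hP : CondP X)
    {A C : X → X}
    (hA : ∀ (u : ℕ → X) (x : X), WeakConv u x → WeakConv (fun n => A (u n)) (A x))
    (hC : ∀ (u : ℕ → X) (x : X), WeakConv u x → WeakConv (fun n => C (u n)) (C x))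
    {u : ℕ → X} {b : X} (hu : WeakConv u b) (x : X) (k : ℕ) :
    WeakConv (fun n => (fun x => A x * u n + C x)^[k] x) ((fun x => A x * b + C x)^[k] x) := by
  induction k with
  | zero => exact fun f => tendsto_const_nhds
  | succ k ih =>
    simp only [Function.iterate_succ_apply']
    exact (hP _ _ _ _ (hA _ _ ih) hu).add (hC _ _ ih)

/-- The contraction `x ↦ A x * b + C x` has a fixed point, approximated by the Picard iteration
uniformly for `b` in a ball. -/
theorem exists_fixedPoint_mul_add {X : Type*} [NormedRing X] [CompleteSpace X] {A C : X → X}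
    {a c β : ℝ} (ha : 0 ≤ a) (hc : 0 ≤ c) (hβ : 0 ≤ β)
    (hA : ∀ x y : X, ‖A x - A y‖ ≤ a * ‖x - y‖) (hC : ∀ x y : X, ‖C x - C y‖ ≤ c * ‖x - y‖)
    (h : β * a + c < 1) (b : X) (hb : ‖b‖ ≤ β) :
    ∃ x, x = A x * b + C x ∧ ∀ k, ‖(fun x => A x * b + C x)^[k] 0 - x‖ ≤
      (‖A 0‖ * β + ‖C 0‖) * (β * a + c) ^ k / (1 - (β * a + c)) := by
  have hq : 0 ≤ β * a + c := by positivity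
  have hF : ContractingWith (NNReal.mk (β * a + c) hq) fun x => A x * b + C x := by
    refine ⟨h, LipschitzWith.of_dist_le_mul fun x y => ?_⟩
    rw [dist_eq_norm, dist_eq_norm, NNReal.coe_mk]
    calc ‖A x * b + C x - (A y * b + C y)‖ = ‖(A x - A y) * b + (C x - C y)‖ := by
          congr 1
          noncomm_ring
      _ ≤ ‖A x - A y‖ * ‖b‖ + ‖C x - C y‖ := by
          grw [norm_add_le, norm_mul_le]
      _ ≤ a * ‖x - y‖ * β + c * ‖x - y‖ := by
          gcongr
          exacts [hA x y, hC x y]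
      _ = _ := by ring
  refine ⟨hF.fixedPoint, hF.fixedPoint_isFixedPt.symm, fun k => ?_⟩
  have h0 : dist 0 (A 0 * b + C 0) ≤ ‖A 0‖ * β + ‖C 0‖ := by
    rw [dist_zero_left]
    grw [norm_add_le, norm_mul_le, hb]
  have hk := hF.apriori_dist_iterate_fixedPoint_le 0 k
  rw [dist_eq_norm, NNReal.coe_mk] at hk
  refine hk.trans ?_
  have : 0 < 1 - (β * a + c) := by linarith
  gcongr

end Hybrid

/-- hybrid fixed point theorem for `x = A x · B x + C x` in a real Banach
algebra with identity satisfying condition (P), on a bounded closed convex set `S`,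
with `B(S)` relatively weakly compact. -/
theorem hybrid_fixedPoint_of_weaklyCompact_B {X : Type*} [NormedRing X]
    [NormedAlgebra ℝ X] [CompleteSpace X] (hP : CondP X)
    (S : Set X) (hne : S.Nonempty) (hbdd : Bornology.IsBounded S)
    (hcl : IsClosed S) (hconv : Convex ℝ S)
    (A B C : X → X)
    (hAwsc : ∀ (u : ℕ → X) (x : X), WeakConv u x → WeakConv (fun n => A (u n)) (A x))
    (hCwsc : ∀ (u : ℕ → X) (x : X), WeakConv u x → WeakConv (fun n => C (u n)) (C x))
    (hBwsc : ∀ (u : ℕ → X) (x : X), (∀ n, u n ∈ S) → x ∈ S →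
      WeakConv u x → WeakConv (fun n => B (u n)) (B x))
    (a c : ℝ) (ha0 : 0 ≤ a) (hc0 : 0 ≤ c)
    (hAlip : ∀ x y : X, ‖A x - A y‖ ≤ a * ‖x - y‖)
    (hClip : ∀ x y : X, ‖C x - C y‖ ≤ c * ‖x - y‖)
    (hAreg : ∀ x : X, IsUnit (A x))
    (hBcomp : RelWeaklyCompact (B '' S))
    (hclosure : ∀ x y : X, y ∈ S → x = A x * B y + C x → x ∈ S)
    (hcontr : sSup ((fun y => ‖B y‖) '' S) * a + c < 1) :
    ∃ x ∈ S, x = A x * B x + C x := by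
  obtain ⟨M, hM⟩ := hBcomp.exists_norm_le
  have hBK : Set.MapsTo B S (weakClosure (B '' S)) := fun y hy =>
    subset_weakClosure _ (Set.mem_image_of_mem _ hy)
  set β := sSup ((fun y => ‖B y‖) '' S) with hβ
  have hBβ : ∀ y ∈ S, ‖B y‖ ≤ β := fun y hy =>
    le_csSup ⟨M, by rintro _ ⟨z, hz, rfl⟩; exact hM _ (hBK hz)⟩ ⟨y, hy, rfl⟩
  have hβ0 : 0 ≤ β := by
    obtain ⟨y, hy⟩ := hne
    exact (norm_nonneg _).trans (hBβ y hy)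
  have hKβ : ∀ b ∈ weakClosure (B '' S), ‖b‖ ≤ β := by
    intro b hb
    have hball : closure (toWeakSpace ℝ X '' (B '' S)) ⊆
        toWeakSpace ℝ X '' Metric.closedBall 0 β := by
      refine closure_minimal (Set.image_mono ?_)
        (isClosed_toWeakSpace_image Metric.isClosed_closedBall (convex_closedBall 0 β))
      rintro _ ⟨y, hy, rfl⟩
      simpa using hBβ y hy
    obtain ⟨b', hb', h⟩ := hball hb
    rw [← (toWeakSpace ℝ X).injective h]
    simpa using hb'
  choose! φ hφ happrox using exists_fixedPoint_mul_add ha0 hc0 hβ0 hAlip hClip hcontr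
  have hδ : Tendsto (fun k : ℕ => (‖A 0‖ * β + ‖C 0‖) * (β * a + c) ^ k / (1 - (β * a + c)))
      atTop (𝓝 0) := by
    simpa using ((tendsto_pow_atTop_nhds_zero_of_lt_one (by positivity) hcontr).const_mul
      (‖A 0‖ * β + ‖C 0‖)).div_const (1 - (β * a + c))
  obtain ⟨x, hx, hfix⟩ := hBcomp.exists_fixedPoint_comp hcl hconv hne hBK
    (fun y hy => hclosure _ y hy (hφ _ (hBβ y hy))) hBwsc fun u b hu hb h =>
      weakConv_of_forall_norm_sub_le hδ (h.iterate hP hAwsc hCwsc 0)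
        (fun k n => happrox _ (hKβ _ (hu n)) k) (happrox b (hKβ b hb))
  have hx' := hφ _ (hBβ x hx)
  rw [hfix] at hx'
  exact ⟨x, hx, hx'⟩
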